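/- arXiv:2507.13126 — 3 statements merged into one kernel-verified Lean document; each statement's English description precedes it below -/
import Mathlib

section
/- For T ∈ A ⊗ B ⊗ C with dim A = 2p + 1, the border rank satisfies R̲(T) ≥ rank(T^{∧p}_A) / C(2p, p), where T^{∧p}_A : Λ^p A ⊗ B* → Λ^{p+1} A ⊗ C is the p-th Koszul flattening and C(2p,p) is the binomial coefficient. -/
open scoped BigOperators TensorProduct
open Module

noncomputable section

/-- A 3-tensor in coordinates has rank at most `r`. -/
def rankLE {ι₁ ι₂ ι₃ : Type*} (T : ι₁ → ι₂ → ι₃ → ℂ) (r : ℕ) : Prop :=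
  ∃ (x : Fin r → ι₁ → ℂ) (y : Fin r → ι₂ → ℂ) (z : Fin r → ι₃ → ℂ),
    ∀ i j k, T i j k = ∑ ℓ, x ℓ i * y ℓ j * z ℓ k

/-- Border rank at most `r`: membership in the closure of tensors of rank at most `r`. -/
def borderRankLE {ι₁ ι₂ ι₃ : Type*} (T : ι₁ → ι₂ → ι₃ → ℂ) (r : ℕ) : Prop :=
  T ∈ closure {T' : ι₁ → ι₂ → ι₃ → ℂ | rankLE T' r}

/-- The border rank of a 3-tensor. -/
def borderRank {ι₁ ι₂ ι₃ : Type*} (T : ι₁ → ι₂ → ι₃ → ℂ) : ℕ :=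
  sInf {r | borderRankLE T r}

/-- Left wedge multiplication by `a_i` as a map `Λ^p A → ExteriorAlgebra A`,
whose image lies in `Λ^{p+1} A`. -/
def wedgeMap (na p : ℕ) (i : Fin na) :
    (⋀[ℂ]^p (Fin na → ℂ)) →ₗ[ℂ] ExteriorAlgebra ℂ (Fin na → ℂ) :=
  (LinearMap.mulLeft ℂ (ExteriorAlgebra.ι ℂ (Pi.single i 1))) ∘ₗ
    (⋀[ℂ]^p (Fin na → ℂ)).subtype

/-- `β ↦ β(b_j) • c_k` as a linear map `B* → C`. -/
def evalSmul (nb nc : ℕ) (j : Fin nb) (k : Fin nc) :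
    Module.Dual ℂ (Fin nb → ℂ) →ₗ[ℂ] (Fin nc → ℂ) :=
  ((Module.Dual.eval ℂ (Fin nb → ℂ)) (Pi.single j 1)).smulRight (Pi.single k 1)

/-- The `p`-th Koszul flattening `T^{∧p}_A : Λ^p A ⊗ B* → Λ^{p+1} A ⊗ C` of a 3-tensor
`T`, sending `X ⊗ β` to `Σ_{ijk} T^{ijk} β(b_j) (a_i ∧ X) ⊗ c_k` (the codomain is
embedded in `ExteriorAlgebra A ⊗ C`). -/
def koszulFlattening (na nb nc p : ℕ) (T : Fin na → Fin nb → Fin nc → ℂ) :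
    ((⋀[ℂ]^p (Fin na → ℂ)) ⊗[ℂ] Module.Dual ℂ (Fin nb → ℂ)) →ₗ[ℂ]
      (ExteriorAlgebra ℂ (Fin na → ℂ) ⊗[ℂ] (Fin nc → ℂ)) :=
  ∑ i, ∑ j, ∑ k, T i j k • TensorProduct.map (wedgeMap na p i) (evalSmul nb nc j k)

/-- Rank is lower semicontinuous along a linear family of linear maps: sublevel sets are closed. -/
theorem isClosed_setOf_rank_le {E V W : Type*} [AddCommGroup E] [Module ℂ E]
    [FiniteDimensional ℂ E] [TopologicalSpace E] [IsTopologicalAddGroup E] [ContinuousSMul ℂ E]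
    [T2Space E] [AddCommGroup V] [Module ℂ V] [FiniteDimensional ℂ V] [AddCommGroup W] [Module ℂ W]
    (L : E →ₗ[ℂ] V →ₗ[ℂ] W) (n : ℕ) :
    IsClosed {x : E | finrank ℂ (LinearMap.range (L x)) ≤ n} := by
  rw [← isOpen_compl_iff, isOpen_iff_mem_nhds]
  intro x₀ hx₀
  replace hx₀ : n < finrank ℂ (LinearMap.range (L x₀)) := by simpa using hx₀
  obtain ⟨π, hπ⟩ := (LinearMap.range (L x₀)).subtype.exists_leftInverse_of_injective
    (Submodule.ker_subtype _)
  let e := (finBasis ℂ (LinearMap.range (L x₀))).equivFun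
  obtain ⟨b, hb⟩ := (L x₀).rangeRestrict.exists_rightInverse_of_surjective
    (L x₀).range_rangeRestrict
  let v := fun i => b (finBasis ℂ (LinearMap.range (L x₀)) i)
  let Φ : E →ₗ[ℂ] (Fin (finrank ℂ (LinearMap.range (L x₀))) →
      Fin (finrank ℂ (LinearMap.range (L x₀))) → ℂ) :=
    LinearMap.pi fun i => (e.toLinearMap ∘ₗ π) ∘ₗ L.flip (v i)
  have hΦ : Continuous Φ := Φ.continuous_of_finiteDimensional
  have hopen := (isOpen_setOfPred_linearIndependent (𝕜 := ℂ)
    (ι := Fin (finrank ℂ (LinearMap.range (L x₀))))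
    (E := Fin (finrank ℂ (LinearMap.range (L x₀))) → ℂ)).preimage hΦ
  have hv : ∀ i, L x₀ (v i) = (finBasis ℂ (LinearMap.range (L x₀)) i : W) := fun i =>
    congrArg Subtype.val (LinearMap.congr_fun hb (finBasis ℂ (LinearMap.range (L x₀)) i))
  refine Filter.mem_of_superset (hopen.mem_nhds ?_) ?_
  · have h₀ : Φ x₀ = e ∘ finBasis ℂ (LinearMap.range (L x₀)) := by
      funext i
      have := LinearMap.congr_fun hπ (finBasis ℂ (LinearMap.range (L x₀)) i)
      simp only [LinearMap.comp_apply, Submodule.subtype_apply, LinearMap.id_apply] at this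
      simp only [Φ, LinearMap.pi_apply, LinearMap.comp_apply, LinearMap.flip_apply, hv, this,
        Function.comp_apply, LinearEquiv.coe_coe]
    change LinearIndependent ℂ (Φ x₀)
    rw [h₀]
    exact (finBasis ℂ _).linearIndependent.map' e.toLinearMap e.ker
  · intro x hx
    replace hx : LinearIndependent ℂ (Φ x) := hx
    have hx' : LinearIndependent ℂ fun i => (L x).rangeRestrict (v i) :=
      LinearIndependent.of_comp (e.toLinearMap ∘ₗ π ∘ₗ (LinearMap.range (L x)).subtype) hx
    have := hx'.fintype_card_le_finrank
    rw [Fintype.card_fin] at this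
    simpa using hx₀.trans_le this

/-- Left multiplication by `ι x` does not see modifications of its argument by an endomorphism
which is the identity modulo `x`. -/
theorem ι_mul_map_eq {A : Type*} [AddCommGroup A] [Module ℂ A] (x : A) (f : A →ₗ[ℂ] A)
    (hf : ∀ m, ∃ c : ℂ, f m = m - c • x) (X : ExteriorAlgebra ℂ A) :
    ExteriorAlgebra.ι ℂ x * ExteriorAlgebra.map f X = ExteriorAlgebra.ι ℂ x * X := by
  induction X using CliffordAlgebra.left_induction with
  | algebraMap r =>
    exact congrArg _ ((ExteriorAlgebra.map f).commutes r)
  | add X Y hX hY => rw [map_add, mul_add, mul_add, hX, hY]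
  | ι_mul X m hX =>
    change _ * ExteriorAlgebra.map f (ExteriorAlgebra.ι ℂ m * X) =
      _ * (ExteriorAlgebra.ι ℂ m * X)
    obtain ⟨c, hc⟩ := hf m
    have hswap : ExteriorAlgebra.ι ℂ x * ExteriorAlgebra.ι ℂ m =
        -(ExteriorAlgebra.ι ℂ m * ExteriorAlgebra.ι ℂ x) :=
      eq_neg_of_add_eq_zero_left (ExteriorAlgebra.ι_add_mul_swap x m)
    have hfm : ExteriorAlgebra.ι ℂ x * ExteriorAlgebra.ι ℂ (f m) =
        ExteriorAlgebra.ι ℂ x * ExteriorAlgebra.ι ℂ m := by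
      rw [hc, map_sub, map_smul, mul_sub, mul_smul_comm, ExteriorAlgebra.ι_sq_zero, smul_zero,
        sub_zero]
    rw [map_mul, ExteriorAlgebra.map_apply_ι, ← mul_assoc, hfm, hswap, neg_mul, mul_assoc, hX,
      ← mul_assoc, ← mul_assoc, hswap, neg_mul]

theorem coe_exteriorPower_map {A B : Type*} [AddCommGroup A] [Module ℂ A] [AddCommGroup B]
    [Module ℂ B] (p : ℕ) (f : A →ₗ[ℂ] B) (X : ⋀[ℂ]^p A) :
    (exteriorPower.map p f X : ExteriorAlgebra ℂ B) = ExteriorAlgebra.map f X := by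
  have : (⋀[ℂ]^p B).subtype ∘ₗ exteriorPower.map p f =
      (ExteriorAlgebra.map f).toLinearMap ∘ₗ (⋀[ℂ]^p A).subtype := by
    ext m
    simp [exteriorPower.map_apply_ιMulti, ExteriorAlgebra.map_apply_ιMulti]
  exact LinearMap.congr_fun this X

/-- Wedging with a fixed vector has rank at most `C(dim A - 1, p)` on `Λ^p A`. -/
theorem rank_mulLeft_ι_le {A : Type*} [AddCommGroup A] [Module ℂ A] [FiniteDimensional ℂ A]
    (n p : ℕ) (hA : finrank ℂ A = n + 1) (x : A) :
    (LinearMap.mulLeft ℂ (ExteriorAlgebra.ι ℂ x) ∘ₗ (⋀[ℂ]^p A).subtype).rank ≤ n.choose p := by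
  rcases eq_or_ne x 0 with rfl | hx
  · simp
  obtain ⟨φ, hφ⟩ := Projective.exists_dual_eq_one ℂ hx
  let g : A →ₗ[ℂ] A := LinearMap.id - φ.smulRight x
  have hg : ∀ m, g m = m - φ m • x := fun m => rfl
  have hmem : ∀ m, g m ∈ LinearMap.ker φ := fun m => by simp [hg, hφ]
  have hker : finrank ℂ (LinearMap.ker φ) = n := by
    have h₁ := φ.finrank_range_add_finrank_ker
    have h₂ : LinearMap.range φ = ⊤ :=
      LinearMap.range_eq_top.2 fun c => ⟨c • x, by simp [hφ]⟩
    rw [h₂, finrank_top, finrank_self, hA] at h₁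
    omega
  have hfac : LinearMap.mulLeft ℂ (ExteriorAlgebra.ι ℂ x) ∘ₗ (⋀[ℂ]^p A).subtype =
      (LinearMap.mulLeft ℂ (ExteriorAlgebra.ι ℂ x) ∘ₗ (⋀[ℂ]^p A).subtype ∘ₗ
        exteriorPower.map p (LinearMap.ker φ).subtype) ∘ₗ
        exteriorPower.map p (g.codRestrict _ hmem) := by
    rw [LinearMap.comp_assoc, LinearMap.comp_assoc, ← exteriorPower.map_comp,
      LinearMap.subtype_comp_codRestrict]
    ext1
    refine AlternatingMap.ext fun m => ?_
    simpa [coe_exteriorPower_map] using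
      (ι_mul_map_eq x g (fun m => ⟨φ m, hg m⟩) (ExteriorAlgebra.ιMulti ℂ p m)).symm
  rw [hfac]
  refine (LinearMap.rank_comp_le_left _ _).trans ((LinearMap.rank_le_domain _).trans ?_)
  rw [← finrank_eq_rank, exteriorPower.finrank_eq, hker]

/-- Tensoring with a map of rank one does not increase the rank. -/
theorem rank_map_smulRight_le {V W B C : Type} [AddCommGroup V] [Module ℂ V] [AddCommGroup W]
    [Module ℂ W] [AddCommGroup B] [Module ℂ B] [AddCommGroup C] [Module ℂ C]
    (f : V →ₗ[ℂ] W) (φ : Module.Dual ℂ B) (z : C) :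
    (TensorProduct.map f (φ.smulRight z)).rank ≤ f.rank := by
  have h : TensorProduct.map f (φ.smulRight z) =
      (TensorProduct.mk ℂ W C).flip z ∘ₗ f ∘ₗ
        (TensorProduct.rid ℂ V).toLinearMap ∘ₗ TensorProduct.map LinearMap.id φ := by
    ext v b
    simp
  rw [h]
  exact (LinearMap.rank_comp_le_right _ _).trans (LinearMap.rank_comp_le_left _ _)

/-- A sum of `r` tensor products of maps of rank at most `c` with maps of rank one has rank at
most `c * r`. -/
theorem finrank_range_sum_map_smulRight_le {V W B C : Type} [AddCommGroup V] [Module ℂ V]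
    [Ring W] [Algebra ℂ W] [AddCommGroup B] [Module ℂ B] [AddCommGroup C] [Module ℂ C] {c r : ℕ}
    (f : Fin r → V →ₗ[ℂ] W) (φ : Fin r → Module.Dual ℂ B) (z : Fin r → C)
    (hf : ∀ ℓ, (f ℓ).rank ≤ c) :
    finrank ℂ (LinearMap.range (∑ ℓ, TensorProduct.map (f ℓ) ((φ ℓ).smulRight (z ℓ)))) ≤
      c * r := by
  refine finrank_le_of_rank_le ((LinearMap.rank_finsetSum_le _ _).trans
    ((Finset.sum_le_sum fun ℓ _ => (rank_map_smulRight_le _ _ _).trans (hf ℓ)).trans ?_))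
  simp [mul_comm]

/-- Rank sublevel sets are closed in a linear family of maps between tensor products. -/
theorem isClosed_setOf_rank_tensorProduct_le {E V W B C : Type} [AddCommGroup E] [Module ℂ E]
    [FiniteDimensional ℂ E] [TopologicalSpace E] [IsTopologicalAddGroup E] [ContinuousSMul ℂ E]
    [T2Space E] [AddCommGroup V] [Module ℂ V] [FiniteDimensional ℂ V] [Ring W] [Algebra ℂ W]
    [AddCommGroup B] [Module ℂ B] [FiniteDimensional ℂ B] [AddCommGroup C] [Module ℂ C]
    (L : E →ₗ[ℂ] (V ⊗[ℂ] B) →ₗ[ℂ] (W ⊗[ℂ] C)) (n : ℕ) :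
    IsClosed {x : E | finrank ℂ (LinearMap.range (L x)) ≤ n} :=
  isClosed_setOf_rank_le L n

/-- The Koszul flattening as a linear function of the tensor. -/
def koszulFlatteningLinear (na nb nc p : ℕ) :
    (Fin na → Fin nb → Fin nc → ℂ) →ₗ[ℂ]
      ((⋀[ℂ]^p (Fin na → ℂ)) ⊗[ℂ] Module.Dual ℂ (Fin nb → ℂ)) →ₗ[ℂ]
      (ExteriorAlgebra ℂ (Fin na → ℂ) ⊗[ℂ] (Fin nc → ℂ)) where
  toFun := koszulFlattening na nb nc p
  map_add' S T := by
    simp only [koszulFlattening, Pi.add_apply, add_smul, Finset.sum_add_distrib]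
  map_smul' c T := by
    simp only [koszulFlattening, Pi.smul_apply, smul_eq_mul, mul_smul, Finset.smul_sum,
      RingHom.id_apply]

/-- The Koszul flattening of a decomposable tensor is a tensor product of maps. -/
theorem koszulFlattening_decomposable (na nb nc p : ℕ) (x : Fin na → ℂ) (y : Fin nb → ℂ)
    (z : Fin nc → ℂ) :
    koszulFlattening na nb nc p (fun i j k => x i * y j * z k) =
      TensorProduct.map
        (LinearMap.mulLeft ℂ (ExteriorAlgebra.ι ℂ x) ∘ₗ (⋀[ℂ]^p (Fin na → ℂ)).subtype)
        ((Module.Dual.eval ℂ (Fin nb → ℂ) y).smulRight z) := by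
  refine TensorProduct.ext' fun X β => ?_
  have hx : x = ∑ i, x i • Pi.single i (1 : ℂ) := by
    simpa using (Pi.basisFun ℂ (Fin na)).sum_repr x |>.symm
  have hy : y = ∑ i, y i • Pi.single i (1 : ℂ) := by
    simpa using (Pi.basisFun ℂ (Fin nb)).sum_repr y |>.symm
  have hz : z = ∑ i, z i • Pi.single i (1 : ℂ) := by
    simpa using (Pi.basisFun ℂ (Fin nc)).sum_repr z |>.symm
  have hX : ExteriorAlgebra.ι ℂ x * (X : ExteriorAlgebra ℂ (Fin na → ℂ)) =
      ∑ i, x i • wedgeMap na p i X := by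
    conv_lhs => rw [hx]
    simp [wedgeMap, Finset.sum_mul]
  have hβ : β y • z = ∑ j, ∑ k, (y j * z k) • evalSmul nb nc j k β := by
    have hβy : β y = ∑ j, y j * β (Pi.single j 1) := by
      conv_lhs => rw [hy]
      simp only [map_sum, map_smul, smul_eq_mul]
    have happly : ∀ j k, evalSmul nb nc j k β = β (Pi.single j 1) • Pi.single k 1 :=
      fun _ _ => rfl
    conv_lhs => rw [hβy, hz, Finset.sum_smul]
    simp only [happly, Finset.smul_sum, smul_smul]
    refine Finset.sum_congr rfl fun j _ => Finset.sum_congr rfl fun k _ => ?_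
    congr 1
    ring
  simp only [TensorProduct.map_tmul, LinearMap.comp_apply, LinearMap.mulLeft_apply,
    Submodule.subtype_apply, LinearMap.smulRight_apply, Module.Dual.eval_apply, hX, hβ]
  simp only [koszulFlattening, LinearMap.sum_apply, LinearMap.smul_apply, TensorProduct.map_tmul]
  rw [TensorProduct.sum_tmul]
  refine Finset.sum_congr rfl fun i _ => ?_
  simp only [TensorProduct.tmul_sum, TensorProduct.tmul_smul, ← TensorProduct.smul_tmul',
    smul_smul]
  refine Finset.sum_congr rfl fun j _ => Finset.sum_congr rfl fun k _ => ?_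
  congr 1
  ring

/-- The Koszul flattening bound for tensors of rank at most `r`. -/
theorem finrank_koszulFlattening_le_of_rankLE (n nb nc p r : ℕ)
    (T : Fin (n + 1) → Fin nb → Fin nc → ℂ) (hT : rankLE T r) :
    finrank ℂ (LinearMap.range (koszulFlattening (n + 1) nb nc p T)) ≤ n.choose p * r := by
  obtain ⟨x, y, z, h⟩ := hT
  have hsum : T = ∑ ℓ, fun i j k => x ℓ i * y ℓ j * z ℓ k := by
    funext i j k
    simp [h]
  have hK : koszulFlattening (n + 1) nb nc p T = ∑ ℓ, TensorProduct.map
      (LinearMap.mulLeft ℂ (ExteriorAlgebra.ι ℂ (x ℓ)) ∘ₗ (⋀[ℂ]^p (Fin (n + 1) → ℂ)).subtype)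
      ((Module.Dual.eval ℂ (Fin nb → ℂ) (y ℓ)).smulRight (z ℓ)) := by
    simp_rw [← koszulFlattening_decomposable]
    rw [hsum]
    exact map_sum (koszulFlatteningLinear (n + 1) nb nc p) _ _
  rw [hK]
  exact finrank_range_sum_map_smulRight_le _ _ _ fun ℓ => rank_mulLeft_ι_le n p (by simp) (x ℓ)

theorem exists_rankLE {na nb nc : ℕ} (T : Fin na → Fin nb → Fin nc → ℂ) : ∃ r, rankLE T r := by
  let e := (Fintype.equivFin (Fin na × Fin nb × Fin nc)).symm
  refine ⟨_, fun ℓ => Pi.single (e ℓ).1 1, fun ℓ => Pi.single (e ℓ).2.1 1,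
    fun ℓ => Pi.single (e ℓ).2.2 (T (e ℓ).1 (e ℓ).2.1 (e ℓ).2.2), fun i j k => ?_⟩
  rw [Equiv.sum_comp e fun t : Fin na × Fin nb × Fin nc =>
    (Pi.single t.1 1 : Fin na → ℂ) i * (Pi.single t.2.1 1 : Fin nb → ℂ) j *
      (Pi.single t.2.2 (T t.1 t.2.1 t.2.2) : Fin nc → ℂ) k]
  simp [Fintype.sum_prod_type, Pi.single_apply]

theorem borderRankLE_borderRank {na nb nc : ℕ} (T : Fin na → Fin nb → Fin nc → ℂ) :
    borderRankLE T (borderRank T) := by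
  obtain ⟨r, hr⟩ := exists_rankLE T
  exact Nat.sInf_mem (s := {r | borderRankLE T r}) ⟨r, subset_closure hr⟩

/-- Landsberg–Ottaviani: if `dim A = 2p + 1`, then
`C(2p, p) · R̲(T) ≥ rank(T^{∧p}_A)`. -/
theorem koszul_flattening_lower_bound (p nb nc : ℕ)
    (T : Fin (2 * p + 1) → Fin nb → Fin nc → ℂ) :
    finrank ℂ (LinearMap.range (koszulFlattening (2 * p + 1) nb nc p T)) ≤
      Nat.choose (2 * p) p * borderRank T :=
  closure_minimal
    (fun S hS => finrank_koszulFlattening_le_of_rankLE (2 * p) nb nc p (borderRank T) S hS)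
    (isClosed_setOf_rank_tensorProduct_le (koszulFlatteningLinear (2 * p + 1) nb nc p) _)
    (borderRankLE_borderRank T)
end
end

section
/- Fix q ≥ 3 and m = 2, and let S_q = T_{cw,q}^{⊠2} − T_{cw,q-1}^{⊠2}. The restricted first Koszul flattening (S_q^{∧1})_{A'} : A' ⊗ (B^{⊗2})* → Λ²A' ⊗ C^{⊗2} has rank exactly 4q + 6. -/
open scoped BigOperators TensorProduct
open Module

noncomputable section

/-- The little Coppersmith–Winograd tensor `T_{cw,q}` embedded in `(ℂ^N)^{⊗3}`:
`Σ_{j=1}^q (a₀⊗b_j⊗c_j + a_j⊗b₀⊗c_j + a_j⊗b_j⊗c₀)`. -/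
def TcwE (q N : ℕ) : Fin N → Fin N → Fin N → ℂ := fun i j k =>
  (if i.val = 0 ∧ j = k ∧ 1 ≤ j.val ∧ j.val ≤ q then 1 else 0) +
  (if j.val = 0 ∧ i = k ∧ 1 ≤ i.val ∧ i.val ≤ q then 1 else 0) +
  (if k.val = 0 ∧ i = j ∧ 1 ≤ i.val ∧ i.val ≤ q then 1 else 0)

/-- Kronecker product of two 3-tensors in coordinates. -/
def kron2 {ι κ : Type*} (T : ι → ι → ι → ℂ) (S : κ → κ → κ → ℂ) :
    ι × κ → ι × κ → ι × κ → ℂ :=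
  fun i j k => T i.1 j.1 k.1 * S i.2 j.2 k.2

/-- The Kronecker square `T_{cw,q}^{⊠2}`, in `((ℂ^{q+1})^{⊗2})^{⊗3}` coordinates. -/
def Tsq (q : ℕ) : (Fin (q+1) × Fin (q+1)) → (Fin (q+1) × Fin (q+1)) → (Fin (q+1) × Fin (q+1)) → ℂ :=
  kron2 (TcwE q (q+1)) (TcwE q (q+1))

/-- The difference tensor `S_q = T_{cw,q}^{⊠2} − T_{cw,q−1}^{⊠2}` (with `T_{cw,q−1}`
embedded in `(ℂ^{q+1})^{⊗3}`). -/
def Ssq (q : ℕ) : (Fin (q+1) × Fin (q+1)) → (Fin (q+1) × Fin (q+1)) → (Fin (q+1) × Fin (q+1)) → ℂ :=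
  fun i j k => Tsq q i j k - kron2 (TcwE (q-1) (q+1)) (TcwE (q-1) (q+1)) i j k

/-- The map `φ₂ : A^{⊗2} → A'` on basis indices: `(0,0) ↦ e₀`; `(1,0),(0,1) ↦ e₁`;
`(2,0),(0,2) ↦ e₂`; everything else to `0`. -/
def phi2 (q : ℕ) (I : Fin (q+1) × Fin (q+1)) : Fin 3 → ℂ :=
  if I.1.val = 0 ∧ I.2.val = 0 then Pi.single 0 1
  else if (I.1.val = 1 ∧ I.2.val = 0) ∨ (I.1.val = 0 ∧ I.2.val = 1) then Pi.single 1 1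
  else if (I.1.val = 2 ∧ I.2.val = 0) ∨ (I.1.val = 0 ∧ I.2.val = 2) then Pi.single 2 1
  else 0

/-- The restricted first Koszul flattening
`(T^{∧1})_{A'} : A' ⊗ (B^{⊗2})* → Λ²A' ⊗ C^{⊗2}`, sending `X ⊗ β` to
`Σ_{I,J,K} T^{IJK} β(b_J) (φ₂(a_I) ∧ X) ⊗ c_K` (codomain embedded in
`ExteriorAlgebra A' ⊗ C^{⊗2}`). -/
def flat2 (q : ℕ)
    (T : (Fin (q+1) × Fin (q+1)) → (Fin (q+1) × Fin (q+1)) → (Fin (q+1) × Fin (q+1)) → ℂ) :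
    ((Fin 3 → ℂ) ⊗[ℂ] Module.Dual ℂ ((Fin (q+1) × Fin (q+1)) → ℂ)) →ₗ[ℂ]
      (ExteriorAlgebra ℂ (Fin 3 → ℂ) ⊗[ℂ] ((Fin (q+1) × Fin (q+1)) → ℂ)) :=
  ∑ I, ∑ J, ∑ K, T I J K •
    TensorProduct.map
      ((LinearMap.mulLeft ℂ (ExteriorAlgebra.ι ℂ (phi2 q I))) ∘ₗ (ExteriorAlgebra.ι ℂ))
      (((Module.Dual.eval ℂ ((Fin (q+1) × Fin (q+1)) → ℂ)) (Pi.single J 1)).smulRight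
        (Pi.single K 1))

/-- Basis vector `e_i` of `A' = ℂ³`. -/
def e (i : Fin 3) : Fin 3 → ℂ := Pi.single i 1

/-- The dual basis vector `β_J` of `(B^{⊗2})*`. -/
def β (q : ℕ) (J : Fin (q+1) × Fin (q+1)) :
    Module.Dual ℂ ((Fin (q+1) × Fin (q+1)) → ℂ) := LinearMap.proj J

/-- The basis vector `c_K` of `C^{⊗2}`. -/
def c (q : ℕ) (K : Fin (q+1) × Fin (q+1)) : (Fin (q+1) × Fin (q+1)) → ℂ := Pi.single K 1

/-- Wedge `e_i ∧ e_j` inside the exterior algebra of `A'`. -/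
def w (i j : Fin 3) : ExteriorAlgebra ℂ (Fin 3 → ℂ) :=
  ExteriorAlgebra.ι ℂ (e i) * ExteriorAlgebra.ι ℂ (e j)

/-- The cross product as an alternating map. -/
def crossAlternating : (Fin 3 → ℂ) [⋀^Fin 2]→ₗ[ℂ] (Fin 3 → ℂ) :=
  AlternatingMap.mk
    (MultilinearMap.mk (fun v => crossProduct (v 0) (v 1))
      (by intro _ m i x y; fin_cases i <;> simp)
      (by intro _ m i x y; fin_cases i <;> simp))
    (by
      intro v i j h hij
      have h01 : v 0 = v 1 := by
        fin_cases i <;> fin_cases j <;> simp_all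
      simp [h01])

/-- The linear map on the exterior algebra that identifies the bivectors with `ℂ³`. -/
def bivectorCoord : ExteriorAlgebra ℂ (Fin 3 → ℂ) →ₗ[ℂ] (Fin 3 → ℂ) :=
  ExteriorAlgebra.liftAlternating (Function.update (fun _ => 0) 2 crossAlternating)

theorem bivectorCoord_ι_mul_ι (x y : Fin 3 → ℂ) :
    bivectorCoord (ExteriorAlgebra.ι ℂ x * ExteriorAlgebra.ι ℂ y) = crossProduct x y := by
  have := ExteriorAlgebra.liftAlternating_apply_ιMulti
    (Function.update (fun _ => 0) 2 crossAlternating) ![x, y]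
  simpa [ExteriorAlgebra.ιMulti_apply, crossAlternating, bivectorCoord] using this

/-- The coefficient functional of `ExteriorAlgebra A' ⊗ C^{⊗2}` at the `k`-th bivector coordinate
and the basis vector `c_K`. -/
def coeffAt {q : ℕ} (k : Fin 3) (K : Fin (q+1) × Fin (q+1)) :
    Module.Dual ℂ (ExteriorAlgebra ℂ (Fin 3 → ℂ) ⊗[ℂ] ((Fin (q+1) × Fin (q+1)) → ℂ)) :=
  LinearMap.mul' ℂ ℂ ∘ₗ
    TensorProduct.map (LinearMap.proj k ∘ₗ bivectorCoord) (LinearMap.proj K)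

theorem coeffAt_tmul {q : ℕ} (k : Fin 3) (K : Fin (q+1) × Fin (q+1)) (x y : Fin 3 → ℂ)
    (f : (Fin (q+1) × Fin (q+1)) → ℂ) :
    coeffAt k K ((ExteriorAlgebra.ι ℂ x * ExteriorAlgebra.ι ℂ y) ⊗ₜ f) =
      crossProduct x y k * f K := by
  simp [coeffAt, bivectorCoord_ι_mul_ι]

theorem flat2_tmul (q : ℕ)
    (T : (Fin (q+1) × Fin (q+1)) → (Fin (q+1) × Fin (q+1)) → (Fin (q+1) × Fin (q+1)) → ℂ)
    (X : Fin 3 → ℂ) (J : Fin (q+1) × Fin (q+1)) :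
    flat2 q T (X ⊗ₜ β q J) =
      ∑ I, (ExteriorAlgebra.ι ℂ (phi2 q I) * ExteriorAlgebra.ι ℂ X) ⊗ₜ T I J := by
  simp only [flat2, LinearMap.sum_apply]
  refine Finset.sum_congr rfl fun I _ => ?_
  rw [Finset.sum_eq_single J]
  · conv_rhs => rw [pi_eq_sum_univ' (T I J), TensorProduct.tmul_sum]
    refine Finset.sum_congr rfl fun K _ => ?_
    simp [β, TensorProduct.tmul_smul]
  · intro J' _ h
    refine Finset.sum_eq_zero fun K _ => ?_
    simp [β, h.symm]
  · simp

/-- The slices of `S_q` along the basis of `A'`. -/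
def sliceSsq (q : ℕ) (s : Fin 3) (J K : Fin (q+1) × Fin (q+1)) : ℂ :=
  if s = 0 then
    if J = K ∧ 1 ≤ J.1.val ∧ 1 ≤ J.2.val ∧ (J.1.val = q ∨ J.2.val = q) then 1 else 0
  else
    if (J.2.val = q ∧ K.2.val = q ∧
          (J.1.val = 0 ∧ K.1.val = s.val ∨ J.1.val = s.val ∧ K.1.val = 0)) ∨
        (J.1.val = q ∧ K.1.val = q ∧
          (J.2.val = 0 ∧ K.2.val = s.val ∨ J.2.val = s.val ∧ K.2.val = 0)) then 1 else 0

theorem TcwE_zero {q N : ℕ} (i j k : Fin N) (hi : i.val = 0) :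
    TcwE q N i j k = if j = k ∧ 1 ≤ j.val ∧ j.val ≤ q then 1 else 0 := by
  simp [TcwE, hi]

theorem TcwE_pos {q N : ℕ} (i j k : Fin N) (hi : 1 ≤ i.val) (hq : i.val ≤ q) :
    TcwE q N i j k =
      if j.val = 0 ∧ k = i ∨ j = i ∧ k.val = 0 then 1 else 0 := by
  simp only [TcwE]
  grind

theorem Ssq_zero {q : ℕ} (hq : 3 ≤ q) :
    Ssq q (0, 0) = sliceSsq q 0 := by
  funext J K
  obtain ⟨J1, J2⟩ := J
  obtain ⟨K1, K2⟩ := K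
  simp only [Ssq, Tsq, kron2, sliceSsq]
  simp only [TcwE_zero (0 : Fin (q+1)) _ _ rfl]
  grind

theorem Ssq_pos {q : ℕ} (hq : 3 ≤ q) (s : Fin 3) (hs : s ≠ 0) (i : Fin (q+1))
    (hi : i.val = s.val) :
    Ssq q (i, 0) + Ssq q (0, i) = sliceSsq q s := by
  funext J K
  obtain ⟨J1, J2⟩ := J
  obtain ⟨K1, K2⟩ := K
  have h1 : 1 ≤ i.val := by omega
  have h2 : i.val ≤ q - 1 := by omega
  have hdiff (j k : Fin (q+1)) : ((if j = k ∧ 1 ≤ j.val ∧ j.val ≤ q then 1 else 0) : ℂ) -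
      (if j = k ∧ 1 ≤ j.val ∧ j.val ≤ q - 1 then 1 else 0) =
        if j.val = q ∧ k.val = q then 1 else 0 := by
    grind
  simp only [Pi.add_apply, Ssq, Tsq, kron2, sliceSsq, if_neg hs]
  simp only [TcwE_zero (0 : Fin (q+1)) _ _ rfl, TcwE_pos i _ _ h1 h2,
    TcwE_pos i _ _ h1 (h2.trans (Nat.sub_le q 1)), ← mul_sub, ← sub_mul, hdiff]
  simp only [Fin.ext_iff, hi, ite_zero_mul_ite_zero, mul_one]
  grind

theorem flat2_Ssq_tmul {q : ℕ} (hq : 3 ≤ q) (x : Fin 3) (J : Fin (q+1) × Fin (q+1)) :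
    flat2 q (Ssq q) (e x ⊗ₜ β q J) = ∑ s, w s x ⊗ₜ sliceSsq q s J := by
  obtain ⟨one, h1⟩ : ∃ i : Fin (q+1), i.val = 1 := ⟨⟨1, by omega⟩, rfl⟩
  obtain ⟨two, h2⟩ : ∃ i : Fin (q+1), i.val = 2 := ⟨⟨2, by omega⟩, rfl⟩
  have p0 : phi2 q (0, 0) = e 0 := by simp [phi2, e]
  have p1 : phi2 q (one, 0) = e 1 := by simp [phi2, e, h1]
  have p1' : phi2 q (0, one) = e 1 := by simp [phi2, e, h1]
  have p2 : phi2 q (two, 0) = e 2 := by simp [phi2, e, h2]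
  have p2' : phi2 q (0, two) = e 2 := by simp [phi2, e, h2]
  rw [flat2_tmul, ← Finset.sum_subset
    (Finset.subset_univ {(0, 0), (one, 0), (0, one), (two, 0), (0, two)})]
  · rw [Finset.sum_insert, Finset.sum_insert, Finset.sum_insert, Finset.sum_insert,
      Finset.sum_singleton, Fin.sum_univ_three, ← Ssq_zero hq,
      ← Ssq_pos hq 1 (by decide) one h1, ← Ssq_pos hq 2 (by decide) two h2]
    · simp only [p0, p1, p1', p2, p2', w, Pi.add_apply, TensorProduct.tmul_add]
      abel
    all_goals simp [Fin.ext_iff, h1, h2]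
  · rintro ⟨I1, I2⟩ _ hI
    have : phi2 q (I1, I2) = 0 := by
      simp only [Finset.mem_insert, Finset.mem_singleton, Prod.mk.injEq, Fin.ext_iff, h1, h2,
        Fin.val_zero] at hI
      simp only [phi2]
      grind
    simp [this]

theorem coeffAt_flat2_Ssq {q : ℕ} (hq : 3 ≤ q) (k x : Fin 3) (K J : Fin (q+1) × Fin (q+1)) :
    coeffAt k K (flat2 q (Ssq q) (e x ⊗ₜ β q J)) =
      !![0, -sliceSsq q 2 J K, sliceSsq q 1 J K;
        sliceSsq q 2 J K, 0, -sliceSsq q 0 J K;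
        -sliceSsq q 1 J K, sliceSsq q 0 J K, 0] k x := by
  simp only [flat2_Ssq_tmul hq, w, Fin.sum_univ_three, map_add, coeffAt_tmul]
  fin_cases k <;> fin_cases x <;> simp [e, cross_apply]

theorem w_self (i : Fin 3) : w i i = 0 := ExteriorAlgebra.ι_sq_zero _

theorem w_swap (i j : Fin 3) : w i j = -w j i :=
  eq_neg_of_add_eq_zero_left (ExteriorAlgebra.ι_add_mul_swap _ _)

/-- The indices `(x, J)` for which the images of `e_x ⊗ β_J` form a basis of the range. -/
def rankIndex (q : ℕ) : Finset (Fin 3 × (Fin (q+1) × Fin (q+1))) :=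
  {t | t.1 ≠ 0 ∧ (t.2.1.val = q ∨ t.2.2.val = q) ∨
    t.1 = 0 ∧ ((t.2.1.val = 1 ∨ t.2.1.val = 2) ∧ t.2.2.val = q ∨
      t.2.1.val = q ∧ (t.2.2.val = 1 ∨ t.2.2.val = 2))}

theorem mem_rankIndex {q : ℕ} (t : Fin 3 × (Fin (q+1) × Fin (q+1))) :
    t ∈ rankIndex q ↔ t.1 ≠ 0 ∧ (t.2.1.val = q ∨ t.2.2.val = q) ∨
      t.1 = 0 ∧ ((t.2.1.val = 1 ∨ t.2.1.val = 2) ∧ t.2.2.val = q ∨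
        t.2.1.val = q ∧ (t.2.2.val = 1 ∨ t.2.2.val = 2)) := by
  simp [rankIndex]

theorem card_rankIndex {q : ℕ} (hq : 3 ≤ q) : (rankIndex q).card = 4 * q + 6 := by
  have hne (i : Fin q) : i.val ≠ q := i.isLt.ne
  have h1 : 1 ≠ q := by omega
  have h2 : 2 ≠ q := by omega
  have hsum : ∑ i : Fin q, (if i.val = 1 ∨ i.val = 2 then 1 else 0) = 2 := by
    obtain ⟨n, rfl⟩ := Nat.exists_eq_add_of_le' hq
    simp [Fin.sum_univ_succ, -Finset.sum_boole]
  simp only [rankIndex, Finset.card_filter, Fintype.sum_prod_type, Fin.sum_univ_three]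
  simp [Fin.sum_univ_castSucc, hne, h1.symm, h2.symm, hsum, -Finset.sum_boole]
  ring

/-- Functionals biorthogonal to the images of `e_x ⊗ β_J` with `(x, J)` in `rankIndex q`. -/
def dualFamily {q : ℕ} (t : Fin 3 × (Fin (q+1) × Fin (q+1))) :
    Module.Dual ℂ (ExteriorAlgebra ℂ (Fin 3 → ℂ) ⊗[ℂ] ((Fin (q+1) × Fin (q+1)) → ℂ)) :=
  if t.1 = 0 then
    if t.2.1.val = 1 then -coeffAt 2 (0, t.2.2)
    else if t.2.2.val = 1 then -coeffAt 2 (t.2.1, 0)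
    else if t.2.1.val = 2 then coeffAt 1 (0, t.2.2)
    else coeffAt 1 (t.2.1, 0)
  else if t.1 = 1 then
    if t.2.1.val = 0 then -coeffAt 0 (Fin.ofNat (q+1) 2, t.2.2)
    else if t.2.2.val = 0 then -coeffAt 0 (t.2.1, Fin.ofNat (q+1) 2)
    else coeffAt 2 t.2
  else
    if t.2.1.val = 0 then coeffAt 0 (Fin.ofNat (q+1) 1, t.2.2)
    else if t.2.2.val = 0 then coeffAt 0 (t.2.1, Fin.ofNat (q+1) 1)
    else -coeffAt 1 t.2

theorem dualFamily_apply {q : ℕ} (hq : 3 ≤ q) (t s : Fin 3 × (Fin (q+1) × Fin (q+1)))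
    (ht : t ∈ rankIndex q) (hs : s ∈ rankIndex q) :
    dualFamily t (flat2 q (Ssq q) (e s.1 ⊗ₜ β q s.2)) = if t = s then 1 else 0 := by
  rw [mem_rankIndex] at ht hs
  obtain ⟨y, K1, K2⟩ := t
  obtain ⟨x, J1, J2⟩ := s
  have m1 : (Fin.ofNat (q+1) 1).val = 1 := Nat.mod_eq_of_lt (by omega)
  have m2 : (Fin.ofNat (q+1) 2).val = 2 := Nat.mod_eq_of_lt (by omega)
  fin_cases y <;> fin_cases x <;> simp [dualFamily] at ht hs ⊢ <;> split_ifs <;>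
    simp [coeffAt_flat2_Ssq hq, sliceSsq] <;> grind

theorem linearIndependent_flat2_Ssq {q : ℕ} (hq : 3 ≤ q) :
    LinearIndependent ℂ fun t : rankIndex q =>
      flat2 q (Ssq q) (e t.1.1 ⊗ₜ β q t.1.2) :=
  LinearIndependent.of_pairwise_dual_eq_zero_one _ (fun t => dualFamily t.1)
    (fun t s h => by
      simp only [dualFamily_apply hq _ _ t.2 s.2, if_neg (Subtype.coe_injective.ne h)])
    (fun t => by rw [dualFamily_apply hq _ _ t.2 t.2, if_pos rfl])

theorem range_flat2 (q : ℕ)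
    (T : (Fin (q+1) × Fin (q+1)) → (Fin (q+1) × Fin (q+1)) → (Fin (q+1) × Fin (q+1)) → ℂ) :
    LinearMap.range (flat2 q T) = Submodule.span ℂ
      (Set.range fun t : Fin 3 × (Fin (q+1) × Fin (q+1)) => flat2 q T (e t.1 ⊗ₜ β q t.2)) := by
  have hb := ((Pi.basisFun ℂ (Fin 3)).tensorProduct
    (Pi.basisFun ℂ (Fin (q+1) × Fin (q+1))).dualBasis).span_eq
  rw [LinearMap.range_eq_map, ← hb, Submodule.map_span, ← Set.range_comp]
  congr 2
  funext ⟨x, J⟩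
  simp only [Function.comp_apply, Basis.tensorProduct_apply, Pi.basisFun_apply,
    Basis.coe_dualBasis]
  rfl

theorem flat2_Ssq_relation {q : ℕ} (hq : 3 ≤ q) {J J₁ J₂ : Fin (q+1) × Fin (q+1)}
    (h₁ : sliceSsq q 1 J = sliceSsq q 0 J₁) (h₂ : sliceSsq q 2 J = sliceSsq q 0 J₂)
    (h₃ : sliceSsq q 2 J₁ = 0) (h₄ : sliceSsq q 1 J₂ = 0) :
    flat2 q (Ssq q) (e 0 ⊗ₜ β q J) =
      -(flat2 q (Ssq q) (e 1 ⊗ₜ β q J₁) + flat2 q (Ssq q) (e 2 ⊗ₜ β q J₂)) := by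
  simp only [flat2_Ssq_tmul hq, Fin.sum_univ_three, h₁, h₂, h₃, h₄, w_self, w_swap 1 0,
    w_swap 2 0, TensorProduct.neg_tmul, TensorProduct.zero_tmul, TensorProduct.tmul_zero]
  abel

theorem flat2_Ssq_mem_span {q : ℕ} (hq : 3 ≤ q) (t : Fin 3 × (Fin (q+1) × Fin (q+1))) :
    flat2 q (Ssq q) (e t.1 ⊗ₜ β q t.2) ∈ Submodule.span ℂ
      (Set.range fun t : rankIndex q => flat2 q (Ssq q) (e t.1.1 ⊗ₜ β q t.1.2)) := by
  have key (t) (ht : t ∈ rankIndex q) : flat2 q (Ssq q) (e t.1 ⊗ₜ β q t.2) ∈ Submodule.span ℂ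
      (Set.range fun t : rankIndex q => flat2 q (Ssq q) (e t.1.1 ⊗ₜ β q t.1.2)) :=
    Submodule.subset_span ⟨⟨t, ht⟩, rfl⟩
  obtain ⟨one, m1⟩ : ∃ i : Fin (q+1), i.val = 1 := ⟨⟨1, by omega⟩, rfl⟩
  obtain ⟨two, m2⟩ : ∃ i : Fin (q+1), i.val = 2 := ⟨⟨2, by omega⟩, rfl⟩
  by_cases ht : t ∈ rankIndex q
  · exact key t ht
  obtain ⟨x, J1, J2⟩ := t
  have corner (J J₁ J₂ : Fin (q+1) × Fin (q+1))
      (h : J.1.val = 0 ∧ J.2.val = q ∧ J₁ = (one, J.2) ∧ J₂ = (two, J.2) ∨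
        J.2.val = 0 ∧ J.1.val = q ∧ J₁ = (J.1, one) ∧ J₂ = (J.1, two)) :
      flat2 q (Ssq q) (e 0 ⊗ₜ β q J) ∈ Submodule.span ℂ
      (Set.range fun t : rankIndex q => flat2 q (Ssq q) (e t.1.1 ⊗ₜ β q t.1.2)) := by
    rw [flat2_Ssq_relation hq (J := J) (J₁ := J₁) (J₂ := J₂)]
    · refine neg_mem (add_mem (key (1, J₁) ?_) (key (2, J₂) ?_)) <;>
        rw [mem_rankIndex] <;> grind
    all_goals
      funext K
      simp [sliceSsq]
      grind
  by_cases hx : x = 0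
  · subst hx
    by_cases h : J1.val = 0 ∧ J2.val = q
    · exact corner (J1, J2) (one, J2) (two, J2) (by simp [h])
    by_cases h' : J2.val = 0 ∧ J1.val = q
    · exact corner (J1, J2) (J1, one) (J1, two) (by simp [h'])
    have z1 : sliceSsq q 1 (J1, J2) = 0 := by
      rw [mem_rankIndex] at ht
      funext K
      simp [sliceSsq] at ht ⊢
      grind
    have z2 : sliceSsq q 2 (J1, J2) = 0 := by
      rw [mem_rankIndex] at ht
      funext K
      simp [sliceSsq] at ht ⊢
      grind
    simp [flat2_Ssq_tmul hq, Fin.sum_univ_three, z1, z2, w_self]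
  · have z (s : Fin 3) : sliceSsq q s (J1, J2) = 0 := by
      rw [mem_rankIndex] at ht
      funext K
      simp only [sliceSsq, Pi.zero_apply] at ht ⊢
      grind
    simp [flat2_Ssq_tmul hq, z]

/-- For `q ≥ 3`, the restricted first Koszul flattening of
`S_q = T_{cw,q}^{⊠2} − T_{cw,q−1}^{⊠2}` has rank exactly `4q + 6`. -/
theorem flat2_Ssq_rank (q : ℕ) (hq : 3 ≤ q) :
    finrank ℂ (LinearMap.range (flat2 q (Ssq q))) = 4 * q + 6 := by
  have hspan : LinearMap.range (flat2 q (Ssq q)) = Submodule.span ℂ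
      (Set.range fun t : rankIndex q => flat2 q (Ssq q) (e t.1.1 ⊗ₜ β q t.1.2)) := by
    rw [range_flat2]
    apply le_antisymm <;> rw [Submodule.span_le]
    · rintro _ ⟨t, rfl⟩
      exact flat2_Ssq_mem_span hq t
    · rintro _ ⟨t, rfl⟩
      exact Submodule.subset_span ⟨t.1, rfl⟩
  rw [hspan, finrank_span_eq_card (linearIndependent_flat2_Ssq hq), Fintype.card_coe,
    card_rankIndex hq]
end
end

section
/- For every integer q ≥ 3, the border rank of the Kronecker square of the little Coppersmith–Winograd tensor equals (q+2)²: R̲(T_{cw,q}^{⊠2}) = (q+2)². -/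
open scoped BigOperators

noncomputable section

/-- The little Coppersmith–Winograd tensor `T_{cw,q}` in coordinates. -/
def Tcw (q : ℕ) : Fin (q + 1) → Fin (q + 1) → Fin (q + 1) → ℂ :=
  fun i j k =>
    (if i.val = 0 ∧ j = k ∧ 1 ≤ j.val then 1 else 0) +
    (if j.val = 0 ∧ i = k ∧ 1 ≤ i.val then 1 else 0) +
    (if k.val = 0 ∧ i = j ∧ 1 ≤ i.val then 1 else 0)

/-- The Kronecker square `T_{cw,q}^{⊠2}` in coordinates. -/
def TcwSq (q : ℕ) :
    (Fin (q+1) × Fin (q+1)) → (Fin (q+1) × Fin (q+1)) → (Fin (q+1) × Fin (q+1)) → ℂ :=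
  fun i j k => Tcw q i.1 j.1 k.1 * Tcw q i.2 j.2 k.2

/-! ### Upper bound -/

theorem rankLE_card {ι₁ ι₂ ι₃ κ : Type*} [Fintype κ] {T : ι₁ → ι₂ → ι₃ → ℂ} {r : ℕ}
    (hr : Fintype.card κ = r) (x : κ → ι₁ → ℂ) (y : κ → ι₂ → ℂ) (z : κ → ι₃ → ℂ)
    (h : ∀ i j k, T i j k = ∑ ℓ, x ℓ i * y ℓ j * z ℓ k) : rankLE T r := by
  let e := (Fintype.equivFinOfCardEq hr).symm
  refine ⟨fun ℓ => x (e ℓ), fun ℓ => y (e ℓ), fun ℓ => z (e ℓ), fun i j k => ?_⟩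
  rw [h, ← e.sum_comp]

/-- Kronecker products multiply rank. -/
theorem rankLE.kronecker {ι₁ ι₂ ι₃ κ₁ κ₂ κ₃ : Type*} {S : ι₁ → ι₂ → ι₃ → ℂ}
    {T : κ₁ → κ₂ → κ₃ → ℂ} {r s : ℕ} (hS : rankLE S r) (hT : rankLE T s) :
    rankLE (fun (i : ι₁ × κ₁) (j : ι₂ × κ₂) (k : ι₃ × κ₃) => S i.1 j.1 k.1 * T i.2 j.2 k.2)
      (r * s) := by
  obtain ⟨x, y, z, h⟩ := hS
  obtain ⟨x', y', z', h'⟩ := hT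
  refine rankLE_card (κ := Fin r × Fin s) (by simp) (fun ℓ i => x ℓ.1 i.1 * x' ℓ.2 i.2)
    (fun ℓ j => y ℓ.1 j.1 * y' ℓ.2 j.2) (fun ℓ k => z ℓ.1 k.1 * z' ℓ.2 k.2) fun i j k => ?_
  rw [h, h', Finset.sum_mul_sum, Fintype.sum_prod_type]
  refine Finset.sum_congr rfl fun a _ => Finset.sum_congr rfl fun b _ => ?_
  ring

/-- A polynomial family of tensors degenerating to `Tcw q`. -/
def cwFamily (q : ℕ) (ε : ℂ) (i j k : Fin (q + 1)) : ℂ :=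
  Tcw q i j k + if i = 0 then (if j = 0 then 0 else if k = 0 then 0 else -ε)
    else if j = 0 then (if k = 0 then 0 else -ε)
    else if k = 0 then -ε
    else (if i = j ∧ j = k then ε else 0) - ε ^ 3

theorem rankLE_cwFamily (q : ℕ) {ε : ℂ} (hε : ε ≠ 0) : rankLE (cwFamily q ε) (q + 2) := by
  let x : Option (Option (Fin q)) → Fin (q + 1) → ℂ := fun ℓ i =>
    match ℓ with
    | none => if i = 0 then 1 else 0
    | some none => if i = 0 then 1 else ε ^ 2
    | some (some m) => if i = 0 then 1 else if i = m.succ then ε else 0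
  let c : Option (Option (Fin q)) → ℂ := fun ℓ =>
    match ℓ with
    | none => ε⁻¹ ^ 3 - q * ε⁻¹ ^ 2
    | some none => -ε⁻¹ ^ 3
    | some (some _) => ε⁻¹ ^ 2
  refine rankLE_card (κ := Option (Option (Fin q))) (by simp) (fun ℓ i => c ℓ * x ℓ i) x x
    fun i j k => ?_
  simp only [Fintype.sum_option, c, x, cwFamily, Tcw]
  refine Fin.cases ?_ (fun i => ?_) i <;> refine Fin.cases ?_ (fun j => ?_) j <;>
    refine Fin.cases ?_ (fun k => ?_) k <;> simp <;> try split_ifs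
  all_goals first | (field_simp; done) | (field_simp; ring1) | (exfalso; simp_all)

theorem borderRankLE_TcwSq (q : ℕ) : borderRankLE (TcwSq q) ((q + 2) ^ 2) := by
  let S : ℂ → (Fin (q+1) × Fin (q+1)) → (Fin (q+1) × Fin (q+1)) → (Fin (q+1) × Fin (q+1)) → ℂ :=
    fun ε i j k => cwFamily q ε i.1 j.1 k.1 * cwFamily q ε i.2 j.2 k.2
  have hc : Continuous S := by
    refine continuous_pi fun i => continuous_pi fun j => continuous_pi fun k => ?_
    have h : ∀ a b c : Fin (q + 1), Continuous fun ε => cwFamily q ε a b c := fun a b c => by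
      unfold cwFamily
      split_ifs <;> fun_prop
    exact (h _ _ _).mul (h _ _ _)
  have h0 : S 0 = TcwSq q := by
    funext i j k
    simp [S, TcwSq, cwFamily]
  rw [borderRankLE, ← h0]
  refine hc.range_subset_closure_image_dense (dense_compl_singleton 0) |>.trans
    (closure_mono ?_) ⟨0, rfl⟩
  rintro _ ⟨ε, hε, rfl⟩
  rw [Set.mem_ofPred_eq, sq]
  exact (rankLE_cwFamily q hε).kronecker (rankLE_cwFamily q hε)

/-! ### Koszul flattenings -/

/-- The signs of the matrix of `x ∧ ·` from `Λ² R⁵` to `Λ³ R⁵`. The bases are ordered so that the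
bivectors (resp. trivectors) without (resp. with) the factor `e₀` come first. -/
def wedgeSign : Matrix (Fin 10) (Fin 10) ℤ :=
  !![1, 0, 0, 0, 0, 0, 1, 1, 0, 0;
     0, 1, 0, 0, 0, 0, -1, 0, 1, 0;
     0, 0, 1, 0, 0, 0, 0, -1, -1, 0;
     0, 0, 0, 1, 0, 0, 1, 0, 0, 1;
     0, 0, 0, 0, 1, 0, 0, 1, 0, -1;
     0, 0, 0, 0, 0, 1, 0, 0, 1, 1;
     -1, -1, -1, 0, 0, 0, 0, 0, 0, 0;
     1, 0, 0, -1, -1, 0, 0, 0, 0, 0;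
     0, 1, 0, 1, 0, -1, 0, 0, 0, 0;
     0, 0, 1, 0, 1, 1, 0, 0, 0, 0]

/-- The coordinates of `x` occurring in the matrix of `x ∧ ·` from `Λ² R⁵` to `Λ³ R⁵`. -/
def wedgeIndex : Matrix (Fin 10) (Fin 10) (Fin 5) :=
  !![0, 0, 0, 0, 0, 0, 3, 4, 0, 0;
     0, 0, 0, 0, 0, 0, 2, 0, 4, 0;
     0, 0, 0, 0, 0, 0, 0, 2, 3, 0;
     0, 0, 0, 0, 0, 0, 1, 0, 0, 4;
     0, 0, 0, 0, 0, 0, 0, 1, 0, 3;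
     0, 0, 0, 0, 0, 0, 0, 0, 1, 2;
     2, 3, 4, 0, 0, 0, 0, 0, 0, 0;
     1, 0, 0, 3, 4, 0, 0, 0, 0, 0;
     0, 1, 0, 2, 0, 4, 0, 0, 0, 0;
     0, 0, 1, 0, 2, 3, 0, 0, 0, 0]

/-- The matrix of `x ∧ ·` from `Λ² R⁵` to `Λ³ R⁵`. -/
def wedge {R : Type*} [CommRing R] (x : Fin 5 → R) (s t : Fin 10) : R :=
  (wedgeSign s t : R) * x (wedgeIndex s t)

/-- The first six rows and columns give a rank factorization of `wedge x` when `x 0 ≠ 0`. -/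
theorem wedge_factor {R : Type*} [CommRing R] (x : Fin 5 → R) (s t : Fin 10) :
    x 0 * wedge x s t =
      ∑ u : Fin 6, wedge x s (u.castLE (by norm_num)) * wedge x (u.castLE (by norm_num)) t := by
  fin_cases s <;> fin_cases t <;>
    simp [wedge, wedgeSign, wedgeIndex, Fin.sum_univ_succ] <;> ring

theorem det_wedge_sum_eq_zero {m : Type*} [Fintype m] [DecidableEq m] {r : ℕ}
    (hr : 6 * r < Fintype.card m) (s t : m → Fin 10) (x : Fin r → Fin 5 → ℂ)
    (y z : Fin r → m → ℂ) :
    (Matrix.of fun a b => ∑ ℓ, wedge (x ℓ) (s a) (t b) * y ℓ a * z ℓ b).det = 0 := by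
  let N : ℂ → Matrix m m ℂ := fun ε =>
    Matrix.of fun a b => ∑ ℓ, wedge (x ℓ + Pi.single 0 ε) (s a) (t b) * y ℓ a * z ℓ b
  have hN : Continuous fun ε => (N ε).det := by
    refine Continuous.matrix_det (continuous_matrix fun a b => ?_)
    simp only [N, Matrix.of_apply, wedge, Pi.add_apply]
    refine continuous_finsetSum _ fun ℓ _ => ?_
    have : Continuous fun ε : ℂ => (Pi.single 0 ε : Fin 5 → ℂ) (wedgeIndex (s a) (t b)) := by
      simp only [Pi.single_apply]
      split_ifs
      exacts [continuous_id, continuous_const]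
    exact ((continuous_const.mul (continuous_const.add this)).mul continuous_const).mul
      continuous_const
  have hD : Dense ((Finset.univ.image fun ℓ => -x ℓ 0 : Finset ℂ) : Set ℂ)ᶜ :=
    (Finset.countable_toSet _).dense_compl ℂ
  have hz : ∀ ε ∈ ((Finset.univ.image fun ℓ => -x ℓ 0 : Finset ℂ) : Set ℂ)ᶜ, (N ε).det = 0 := by
    intro ε hε
    have hne : ∀ ℓ, (x ℓ + Pi.single 0 ε : Fin 5 → ℂ) 0 ≠ 0 := fun ℓ h => hε (by
      simp only [Finset.coe_image, Finset.coe_univ, Set.image_univ, Set.mem_range]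
      refine ⟨ℓ, ?_⟩
      simp only [Pi.add_apply, Pi.single_eq_same] at h
      linear_combination -h)
    let P : Matrix m (Fin r × Fin 6) ℂ := Matrix.of fun a p =>
      wedge (x p.1 + Pi.single 0 ε) (s a) (p.2.castLE (by norm_num)) * y p.1 a
    let Q : Matrix (Fin r × Fin 6) m ℂ := Matrix.of fun p b =>
      ((x p.1 + Pi.single 0 ε : Fin 5 → ℂ) 0)⁻¹ *
        wedge (x p.1 + Pi.single 0 ε) (p.2.castLE (by norm_num)) (t b) * z p.1 b
    have hPQ : N ε = P * Q := by
      ext a b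
      simp only [N, P, Q, Matrix.of_apply, Matrix.mul_apply, Fintype.sum_prod_type]
      refine Finset.sum_congr rfl fun ℓ _ => ?_
      rw [(eq_inv_mul_iff_mul_eq₀ (hne ℓ)).2 (wedge_factor _ (s a) (t b)), Finset.mul_sum,
        Finset.sum_mul, Finset.sum_mul]
      refine Finset.sum_congr rfl fun u _ => ?_
      ring
    by_contra hdet
    have h1 := Matrix.rank_of_isUnit (N ε) ((Matrix.isUnit_iff_isUnit_det _).2 (Ne.isUnit hdet))
    have h2 : (N ε).rank ≤ Fintype.card (Fin r × Fin 6) := by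
      rw [hPQ]
      exact (Matrix.rank_mul_le_left P Q).trans (Matrix.rank_le_card_width P)
    simp only [Fintype.card_prod, Fintype.card_fin] at h2
    omega
  have := congr_fun (Continuous.ext_on hD hN continuous_const hz) 0
  simpa [N] using this

/-- A minor of the Koszul flattening of the restriction of `T` along the projection that sends the
basis vectors `p α` and `p' α` to `e_α`, and the other basis vectors to `0`. -/
def koszulMinor {ι₁ ι₂ ι₃ m : Type*} (p p' : Fin 5 → ι₁) (ρ : m → Fin 10 × ι₂)
    (γ : m → Fin 10 × ι₃) (T : ι₁ → ι₂ → ι₃ → ℂ) : Matrix m m ℂ :=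
  Matrix.of fun a b => wedge (fun α => T (p α) (ρ a).2 (γ b).2 + T (p' α) (ρ a).2 (γ b).2)
    (ρ a).1 (γ b).1

theorem card_le_of_det_koszulMinor_ne_zero {ι₁ ι₂ ι₃ m : Type*} [Fintype m] [DecidableEq m]
    (p p' : Fin 5 → ι₁) (ρ : m → Fin 10 × ι₂) (γ : m → Fin 10 × ι₃) {T : ι₁ → ι₂ → ι₃ → ℂ}
    (hdet : (koszulMinor p p' ρ γ T).det ≠ 0) {r : ℕ} (hT : borderRankLE T r) :
    Fintype.card m ≤ 6 * r := by
  by_contra! hr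
  have hc : Continuous fun T => (koszulMinor p p' ρ γ T).det := by
    refine Continuous.matrix_det (continuous_matrix fun a b => ?_)
    simp only [koszulMinor, Matrix.of_apply, wedge]
    fun_prop
  refine hdet (closure_minimal ?_ (isClosed_eq hc continuous_const) hT)
  rintro S ⟨x, y, z, h⟩
  refine Eq.trans (congrArg Matrix.det ?_) (det_wedge_sum_eq_zero hr (fun a => (ρ a).1)
    (fun b => (γ b).1) (fun ℓ α => x ℓ (p α) + x ℓ (p' α)) (fun ℓ a => y ℓ (ρ a).2)
    (fun ℓ b => z ℓ (γ b).2))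
  ext a b
  simp only [koszulMinor, Matrix.of_apply, wedge, h, ← Finset.sum_add_distrib, Finset.mul_sum]
  refine Finset.sum_congr rfl fun ℓ _ => ?_
  ring

/-- A square matrix that is triangular with respect to a level function is nonsingular. -/
theorem det_ne_zero_of_triangular {m K : Type*} [Fintype m] [DecidableEq m] [Field K]
    (N : Matrix m m K) (f : m → ℕ) (hd : ∀ a, N a a ≠ 0)
    (h : ∀ a b, a ≠ b → f b ≤ f a → N a b = 0) : N.det ≠ 0 := by
  classical
  intro h0
  obtain ⟨v, hv, hNv⟩ := Matrix.exists_mulVec_eq_zero_iff.2 h0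
  obtain ⟨i, hi⟩ := Function.ne_iff.1 hv
  obtain ⟨a, ha, hmax⟩ := Finset.exists_max_image (Finset.univ.filter fun a => v a ≠ 0) f
    ⟨i, by simpa using hi⟩
  have hNa := congr_fun hNv a
  rw [Matrix.mulVec, dotProduct, Finset.sum_eq_single a] at hNa
  · exact (mul_ne_zero (hd a) (by simpa using ha)) hNa
  · intro b _ hba
    by_cases hb : v b = 0
    · rw [hb, mul_zero]
    · rw [h a b hba.symm (hmax b (by simpa using hb)), zero_mul]
  · simp

/-! ### A nonsingular minor for the Kronecker square -/

/-- Integer entries of `Tcw`, indexed by natural numbers. -/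
def cwEntry (i j k : ℕ) : ℤ :=
  (if i = 0 ∧ j = k ∧ 1 ≤ j then 1 else 0) + (if j = 0 ∧ i = k ∧ 1 ≤ i then 1 else 0) +
    (if k = 0 ∧ i = j ∧ 1 ≤ i then 1 else 0)

theorem Tcw_eq_cwEntry (q : ℕ) (i j k : Fin (q + 1)) : Tcw q i j k = cwEntry i j k := by
  simp only [Tcw, cwEntry, Fin.ext_iff]
  push_cast
  rfl

/-- The first basis vector of the first factor mapped to `e_α`. -/
def firstSlice : Fin 5 → Fin 4 × Fin 4 := ![(0, 0), (1, 0), (0, 1), (0, 2), (0, 3)]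

/-- The second basis vector of the first factor mapped to `e_α`. -/
def secondSlice : Fin 5 → Fin 4 × Fin 4 := ![(2, 3), (2, 2), (2, 0), (3, 0), (1, 1)]

/-- The number standing for the index `j < 4`, or for an arbitrary index `≥ 4` if `b` holds. -/
def standIn (b : Bool) (j : Fin 4) : ℕ := if b then 4 else j

/-- An entry of the Koszul flattening; the flags tell which tensor legs have an index `≥ 4`. -/
def koszulEntry (b₁ b₂ : Bool) (ρ γ : Fin 10 × Fin 4 × Fin 4) : ℤ :=
  wedge (fun α =>
    cwEntry (firstSlice α).1 (standIn b₁ ρ.2.1) (standIn b₁ γ.2.1) *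
      cwEntry (firstSlice α).2 (standIn b₂ ρ.2.2) (standIn b₂ γ.2.2) +
    cwEntry (secondSlice α).1 (standIn b₁ ρ.2.1) (standIn b₁ γ.2.1) *
      cwEntry (secondSlice α).2 (standIn b₂ ρ.2.2) (standIn b₂ γ.2.2)) ρ.1 γ.1

/-- Rows and columns of a triangular minor of the Koszul flattening. -/
def pivots : Bool → Bool → List ((Fin 10 × Fin 4 × Fin 4) × (Fin 10 × Fin 4 × Fin 4))
  | false, false =>
    [((9, 3, 2), (5, 0, 2)), ((4, 0, 2), (7, 1, 2)), ((6, 3, 1), (0, 3, 0)),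
    ((4, 3, 2), (4, 3, 2)), ((8, 1, 1), (1, 0, 1)), ((3, 2, 3), (3, 0, 0)),
    ((6, 3, 3), (2, 3, 0)), ((3, 1, 1), (9, 0, 0)), ((5, 2, 1), (5, 2, 1)),
    ((4, 1, 0), (9, 1, 2)), ((2, 2, 1), (2, 2, 1)), ((3, 0, 3), (6, 1, 3)),
    ((6, 1, 1), (0, 1, 0)), ((3, 2, 2), (6, 0, 0)), ((1, 2, 0), (8, 2, 3)),
    ((9, 2, 2), (4, 0, 2)), ((8, 1, 0), (3, 1, 1)), ((1, 2, 1), (1, 2, 1)),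
    ((7, 1, 2), (3, 1, 0)), ((4, 1, 2), (4, 1, 2)), ((5, 2, 3), (5, 0, 0)),
    ((0, 3, 2), (0, 3, 2)), ((0, 3, 3), (0, 3, 3)), ((0, 2, 3), (7, 2, 0)),
    ((0, 0, 3), (6, 3, 3)), ((1, 0, 1), (6, 2, 1)), ((1, 0, 3), (6, 2, 3)),
    ((4, 3, 0), (9, 3, 2)), ((2, 3, 0), (7, 3, 1)), ((2, 0, 2), (8, 3, 2)),
    ((4, 0, 0), (7, 2, 2)), ((2, 0, 1), (8, 3, 1)), ((8, 1, 3), (1, 0, 3)),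
    ((2, 2, 0), (7, 2, 1)), ((0, 3, 1), (6, 0, 1)), ((4, 2, 2), (9, 2, 0)),
    ((9, 1, 3), (2, 0, 3)), ((7, 2, 2), (0, 0, 0)), ((2, 3, 2), (2, 3, 2)),
    ((2, 3, 1), (7, 3, 0)), ((9, 0, 2), (4, 2, 2)), ((6, 3, 2), (1, 3, 0)),
    ((0, 1, 1), (7, 0, 0)), ((6, 3, 0), (0, 3, 1)), ((4, 3, 3), (9, 0, 3)),
    ((3, 1, 0), (9, 1, 3)), ((2, 2, 3), (2, 0, 0)), ((4, 3, 1), (9, 0, 1)),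
    ((5, 2, 2), (9, 0, 2)), ((2, 1, 2), (2, 1, 2)), ((3, 1, 3), (3, 1, 3)),
    ((9, 2, 0), (5, 2, 2)), ((1, 2, 3), (6, 0, 3)), ((8, 2, 1), (3, 2, 0)),
    ((1, 1, 1), (8, 0, 0)), ((1, 3, 3), (8, 3, 0)), ((5, 0, 0), (8, 2, 2)),
    ((0, 1, 2), (6, 1, 0)), ((9, 1, 2), (2, 0, 2)), ((7, 3, 0), (4, 3, 3)),
    ((7, 0, 2), (0, 1, 2)), ((5, 1, 3), (5, 1, 3)), ((8, 0, 1), (1, 1, 1)),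
    ((9, 3, 1), (5, 0, 1)), ((2, 3, 3), (8, 0, 3)), ((7, 3, 3), (4, 3, 0)),
    ((1, 0, 0), (1, 2, 3)), ((4, 1, 3), (7, 0, 3)), ((7, 1, 0), (4, 1, 3)),
    ((3, 1, 2), (3, 1, 2)), ((1, 1, 0), (8, 1, 3)), ((5, 1, 1), (8, 0, 1)),
    ((3, 0, 1), (6, 1, 1)), ((3, 2, 0), (9, 2, 3)), ((8, 2, 3), (5, 2, 0)),
    ((6, 2, 2), (1, 2, 0)), ((7, 2, 0), (0, 0, 2)), ((5, 0, 2), (9, 2, 2)),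
    ((2, 2, 2), (7, 0, 2)), ((0, 2, 0), (7, 2, 3)), ((6, 1, 0), (0, 1, 1)),
    ((6, 2, 3), (2, 2, 0)), ((9, 1, 1), (2, 0, 1)), ((7, 1, 3), (4, 1, 0)),
    ((1, 2, 2), (6, 0, 2)), ((8, 0, 0), (5, 1, 1)), ((6, 2, 0), (1, 2, 2)),
    ((5, 0, 1), (8, 1, 1)), ((5, 2, 0), (9, 2, 1)), ((6, 2, 1), (0, 2, 0)),
    ((4, 1, 1), (7, 0, 1)), ((5, 1, 2), (8, 0, 2)), ((1, 3, 0), (8, 3, 3)),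
    ((9, 1, 0), (5, 1, 2)), ((7, 0, 0), (4, 1, 1)), ((7, 1, 1), (0, 0, 1)),
    ((1, 1, 3), (8, 1, 0)), ((8, 2, 0), (5, 2, 3)), ((3, 3, 2), (3, 3, 2)),
    ((6, 0, 3), (1, 3, 3)), ((4, 2, 3), (4, 0, 0)), ((3, 0, 2), (6, 1, 2)),
    ((8, 0, 3), (1, 1, 3)), ((8, 2, 2), (1, 0, 0)), ((1, 3, 1), (6, 3, 0)),
    ((9, 3, 0), (4, 3, 1)), ((6, 0, 1), (1, 3, 1)), ((0, 2, 2), (6, 2, 0)),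
    ((9, 2, 3), (4, 0, 3)), ((6, 0, 2), (0, 2, 2)), ((9, 0, 3), (4, 2, 3)),
    ((8, 1, 2), (1, 0, 2)), ((0, 1, 3), (0, 1, 3)), ((0, 0, 1), (6, 3, 1)),
    ((3, 3, 3), (3, 3, 3)), ((8, 3, 0), (5, 3, 3)), ((1, 1, 2), (1, 1, 2)),
    ((4, 0, 3), (7, 1, 3)), ((0, 2, 1), (0, 2, 1)), ((3, 0, 0), (3, 2, 3)),
    ((2, 1, 1), (7, 1, 0)), ((3, 3, 0), (9, 3, 3)), ((7, 3, 1), (3, 0, 1)),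
    ((5, 3, 2), (5, 3, 2)), ((2, 1, 0), (8, 1, 2)), ((5, 3, 1), (9, 3, 0)),
    ((9, 0, 0), (2, 2, 2)), ((2, 0, 0), (2, 2, 3)), ((2, 1, 3), (2, 1, 3)),
    ((7, 3, 2), (3, 0, 2)), ((6, 1, 2), (1, 1, 0)), ((9, 3, 3), (5, 0, 3)),
    ((0, 0, 0), (0, 2, 3)), ((0, 3, 0), (7, 3, 3)), ((9, 0, 1), (5, 3, 1)),
    ((4, 0, 1), (7, 1, 1)), ((3, 2, 1), (3, 2, 1)), ((1, 0, 2), (6, 2, 2)),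
    ((5, 3, 0), (9, 3, 1)), ((8, 3, 1), (3, 3, 0)), ((0, 0, 2), (6, 3, 2)),
    ((9, 2, 1), (4, 0, 1)), ((1, 3, 2), (1, 3, 2)), ((4, 2, 1), (4, 2, 1)),
    ((6, 1, 3), (2, 1, 0)), ((8, 3, 3), (5, 3, 0)), ((5, 1, 0), (9, 1, 1)),
    ((7, 2, 3), (4, 2, 0)), ((6, 0, 0), (2, 1, 1)), ((3, 3, 1), (3, 3, 1))]
  | false, true =>
    [((0, 3, 0), (0, 3, 0)), ((5, 0, 0), (9, 2, 0)), ((2, 0, 0), (8, 3, 0)),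
    ((2, 2, 0), (2, 2, 0)), ((5, 2, 0), (5, 2, 0)), ((1, 0, 0), (6, 2, 0)),
    ((4, 3, 0), (4, 3, 0)), ((4, 0, 0), (9, 3, 0)), ((4, 1, 0), (4, 1, 0)),
    ((1, 2, 0), (1, 2, 0)), ((5, 1, 0), (5, 1, 0)), ((0, 0, 0), (6, 3, 0)),
    ((2, 3, 0), (8, 0, 0)), ((3, 1, 0), (3, 1, 0)), ((9, 0, 0), (2, 1, 0)),
    ((1, 3, 0), (1, 3, 0)), ((4, 2, 0), (4, 2, 0)), ((3, 0, 0), (6, 1, 0)),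
    ((7, 3, 0), (3, 0, 0)), ((7, 0, 0), (3, 3, 0)), ((6, 3, 0), (1, 0, 0)),
    ((0, 2, 0), (0, 2, 0)), ((9, 3, 0), (5, 0, 0)), ((0, 1, 0), (0, 1, 0)),
    ((7, 1, 0), (0, 0, 0)), ((9, 2, 0), (4, 0, 0)), ((9, 1, 0), (2, 0, 0)),
    ((8, 0, 0), (3, 2, 0)), ((5, 3, 0), (5, 3, 0)), ((1, 1, 0), (1, 1, 0))]
  | true, false =>
    [((2, 0, 2), (2, 0, 2)), ((0, 0, 3), (0, 0, 3)), ((6, 0, 1), (0, 0, 0)),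
    ((1, 0, 0), (8, 0, 3)), ((1, 0, 3), (1, 0, 3)), ((4, 0, 2), (4, 0, 2)),
    ((0, 0, 2), (0, 0, 2)), ((5, 0, 0), (9, 0, 1)), ((1, 0, 1), (6, 0, 0)),
    ((5, 0, 1), (5, 0, 1)), ((2, 0, 1), (7, 0, 0)), ((3, 0, 3), (3, 0, 3)),
    ((0, 0, 0), (7, 0, 3)), ((2, 0, 0), (7, 0, 1)), ((6, 0, 3), (2, 0, 0)),
    ((6, 0, 2), (1, 0, 0)), ((8, 0, 0), (3, 0, 1)), ((5, 0, 3), (5, 0, 3)),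
    ((8, 0, 3), (5, 0, 0)), ((7, 0, 0), (4, 0, 3)), ((2, 0, 3), (2, 0, 3)),
    ((9, 0, 0), (4, 0, 1)), ((0, 0, 1), (0, 0, 1)), ((3, 0, 2), (3, 0, 2)),
    ((5, 0, 2), (5, 0, 2)), ((4, 0, 0), (9, 0, 2)), ((7, 0, 2), (3, 0, 0)),
    ((9, 0, 1), (4, 0, 0)), ((3, 0, 0), (9, 0, 3)), ((1, 0, 2), (1, 0, 2))]
  | true, true =>
    [((2, 0, 0), (2, 0, 0)), ((3, 0, 0), (3, 0, 0)), ((4, 0, 0), (4, 0, 0)),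
    ((0, 0, 0), (0, 0, 0)), ((1, 0, 0), (1, 0, 0)), ((5, 0, 0), (5, 0, 0))]

/-- The nonvanishing of `cwEntry`, in a form that is cheap to evaluate. -/
def cwSupport (i j k : ℕ) : Bool :=
  (i.beq 0 && j.beq k && Nat.ble 1 j) || (j.beq 0 && i.beq k && Nat.ble 1 i) ||
    (k.beq 0 && i.beq j && Nat.ble 1 i)

theorem cwEntry_eq_ite (i j k : ℕ) : cwEntry i j k = if cwSupport i j k then 1 else 0 := by
  simp only [cwEntry, cwSupport, Bool.or_eq_true, Bool.and_eq_true, Nat.beq_eq, Nat.ble_eq]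
  split_ifs <;> omega

/-- The nonvanishing of `koszulEntry`, in a form that is cheap to evaluate. -/
def koszulSupport (b₁ b₂ : Bool) (ρ γ : Fin 10 × Fin 4 × Fin 4) : Bool :=
  (!decide (wedgeSign ρ.1 γ.1 = 0)) &&
    ((cwSupport (firstSlice (wedgeIndex ρ.1 γ.1)).1 (standIn b₁ ρ.2.1) (standIn b₁ γ.2.1) &&
      cwSupport (firstSlice (wedgeIndex ρ.1 γ.1)).2 (standIn b₂ ρ.2.2) (standIn b₂ γ.2.2)) ||
    (cwSupport (secondSlice (wedgeIndex ρ.1 γ.1)).1 (standIn b₁ ρ.2.1) (standIn b₁ γ.2.1) &&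
      cwSupport (secondSlice (wedgeIndex ρ.1 γ.1)).2 (standIn b₂ ρ.2.2) (standIn b₂ γ.2.2)))

theorem koszulEntry_ne_zero_iff (b₁ b₂ : Bool) (ρ γ : Fin 10 × Fin 4 × Fin 4) :
    koszulEntry b₁ b₂ ρ γ ≠ 0 ↔ koszulSupport b₁ b₂ ρ γ = true := by
  simp only [koszulEntry, koszulSupport, wedge, cwEntry_eq_ite, ← ite_and, mul_ite, mul_one,
    mul_zero, Bool.and_eq_true, Bool.or_eq_true, Bool.not_eq_true', decide_eq_false_iff_not,
    Int.cast_id, ne_eq, mul_eq_zero, not_or]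
  refine and_congr_right fun _ => ?_
  generalize cwSupport (firstSlice (wedgeIndex ρ.1 γ.1)).1 _ _ = a
  generalize cwSupport (firstSlice (wedgeIndex ρ.1 γ.1)).2 _ _ = b
  generalize cwSupport (secondSlice (wedgeIndex ρ.1 γ.1)).1 _ _ = c
  generalize cwSupport (secondSlice (wedgeIndex ρ.1 γ.1)).2 _ _ = d
  revert a b c d
  decide

/-- Triangularity, with nonzero diagonal, of a minor given by the list of its diagonal positions;
`e` is the support of the matrix. -/
def isTriangular {α : Type*} (e : α → α → Bool) : List (α × α) → Bool
  | [] => true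
  | d :: l => e d.1 d.2 && l.all (fun d' => !e d'.1 d.2) && isTriangular e l

theorem isTriangular_iff {α : Type*} (e : α → α → Bool) (l : List (α × α)) :
    isTriangular e l = true ↔
      (∀ d ∈ l, e d.1 d.2 = true) ∧ l.Pairwise fun d d' => e d'.1 d.2 = false := by
  induction l with
  | nil => simp [isTriangular]
  | cons d l ih =>
    simp only [isTriangular, Bool.and_eq_true, List.all_eq_true, Bool.not_eq_true', ih,
      List.forall_mem_cons, List.pairwise_cons]
    tauto

theorem isTriangular_pivots (b₁ b₂ : Bool) :
    isTriangular (koszulSupport b₁ b₂) (pivots b₁ b₂) = true := by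
  cases b₁ <;> cases b₂ <;> decide +kernel

theorem pivots_diagonal (b₁ b₂ : Bool) :
    ∀ d ∈ pivots b₁ b₂, koszulEntry b₁ b₂ d.1 d.2 ≠ 0 := fun d hd =>
  (koszulEntry_ne_zero_iff _ _ _ _).2
    (((isTriangular_iff _ _).1 (isTriangular_pivots b₁ b₂)).1 d hd)

theorem pivots_triangular (b₁ b₂ : Bool) :
    (pivots b₁ b₂).Pairwise fun d d' => koszulEntry b₁ b₂ d'.1 d.2 = 0 :=
  ((isTriangular_iff _ _).1 (isTriangular_pivots b₁ b₂)).2.imp fun h => by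
    rw [← not_ne_iff, koszulEntry_ne_zero_iff, h]
    exact Bool.false_ne_true

/-- The index of `Fin (q + 1)` described by `j < 4`, or by the number of an index `≥ 4`. -/
def legIndex {q : ℕ} (hq : 3 ≤ q) (c : Option (Fin (q - 3))) (j : Fin 4) : Fin (q + 1) :=
  match c with
  | none => j.castLE (by omega)
  | some e => ⟨4 + e, by omega⟩

theorem Tcw_legIndex {q : ℕ} (hq : 3 ≤ q) (i : Fin 4) (c c' : Option (Fin (q - 3)))
    (j k : Fin 4) :
    Tcw q (i.castLE (by omega)) (legIndex hq c j) (legIndex hq c' k) =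
      if c = c' then (cwEntry i (standIn c.isSome j) (standIn c.isSome k) : ℂ) else 0 := by
  have hi := i.isLt
  have hj := j.isLt
  have hk := k.isLt
  rw [Tcw_eq_cwEntry, ← Int.cast_zero, ← Int.cast_ite (c = c'), Int.cast_inj]
  rcases c with _ | e <;> rcases c' with _ | e' <;>
    simp only [legIndex, standIn, cwEntry, Fin.val_castLE, Option.isSome, reduceCtorEq,
      Option.some.injEq, Fin.ext_iff, true_and, false_and, if_true, if_false] <;>
    split_ifs <;> omega

theorem six_mul_sq_le {q : ℕ} (hq : 3 ≤ q) {r : ℕ} (h : borderRankLE (TcwSq q) r) :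
    6 * (q + 2) ^ 2 ≤ 6 * r := by
  let m := Σ c : Option (Fin (q - 3)) × Option (Fin (q - 3)),
    Fin (pivots c.1.isSome c.2.isSome).length
  let piv : m → (Fin 10 × Fin 4 × Fin 4) × (Fin 10 × Fin 4 × Fin 4) := fun a =>
    (pivots a.1.1.isSome a.1.2.isSome)[a.2]
  let emb : m → (Fin 10 × Fin 4 × Fin 4) → Fin 10 × Fin (q + 1) × Fin (q + 1) := fun a d =>
    (d.1, legIndex hq a.1.1 d.2.1, legIndex hq a.1.2 d.2.2)
  let up : Fin 4 × Fin 4 → Fin (q + 1) × Fin (q + 1) := fun i =>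
    (i.1.castLE (by omega), i.2.castLE (by omega))
  let N : Matrix m m ℂ := koszulMinor (fun α => up (firstSlice α)) (fun α => up (secondSlice α))
    (fun a => emb a (piv a).1) (fun a => emb a (piv a).2) (TcwSq q)
  have hN : ∀ a b : m, N a b =
      if a.1 = b.1 then (koszulEntry a.1.1.isSome a.1.2.isSome (piv a).1 (piv b).2 : ℂ) else 0 := by
    rintro a b
    simp only [N, koszulMinor, Matrix.of_apply, emb, up, TcwSq, Tcw_legIndex, koszulEntry, wedge,
      Prod.ext_iff]
    split_ifs <;> simp_all
  have hdet : N.det ≠ 0 := by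
    refine det_ne_zero_of_triangular N (fun a => a.2) (fun a => ?_) fun a b hab hle => ?_
    · rw [hN, if_pos rfl, Int.cast_ne_zero]
      exact pivots_diagonal _ _ _ (List.getElem_mem _)
    · rw [hN]
      obtain ⟨c, a⟩ := a
      obtain ⟨c', b⟩ := b
      split_ifs with hc
      · obtain rfl : c = c' := hc
        have hlt : b < a := lt_of_le_of_ne hle fun h => hab (by rw [h])
        exact Int.cast_eq_zero.2
          (List.pairwise_iff_getElem.1 (pivots_triangular _ _) b a b.isLt a.isLt hlt)
      · rfl
  have hcard := card_le_of_det_koszulMinor_ne_zero _ _ _ _ hdet h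
  have h4 : (pivots false false).length = 150 ∧ (pivots false true).length = 30 ∧
    (pivots true false).length = 30 ∧ (pivots true true).length = 6 :=
    ⟨rfl, rfl, rfl, rfl⟩
  obtain ⟨k, rfl⟩ := Nat.exists_eq_add_of_le hq
  simp [m, Fintype.sum_prod_type, h4] at hcard
  nlinarith

/-- For every `q ≥ 3`, the border rank of the Kronecker square of the little
Coppersmith–Winograd tensor equals `(q+2)²`. -/
theorem borderRank_TcwSq (q : ℕ) (hq : 3 ≤ q) :
    borderRank (TcwSq q) = (q + 2) ^ 2 := by
  refine le_antisymm (Nat.sInf_le (borderRankLE_TcwSq q)) ?_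
  refine le_csInf ⟨_, borderRankLE_TcwSq q⟩ fun r hr => ?_
  have := six_mul_sq_le hq hr
  omega
end
end
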